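/- arXiv:1907.05445 — 2 statements merged into one kernel-verified Lean document; each statement's English description precedes it below -/
import Mathlib

section
/- Let G be a finite connected distance-hereditary graph. If there is a vertex v with e(v) > rad(G) such that every neighbor w of v satisfies e(w) ≥ e(v), then e(v) = rad(G) + 1 and diam(G) = 2·rad(G). -/
/-- A graph is distance-hereditary if every connected induced subgraph is isometric
(equivalently, every induced path is a shortest path). -/
def DistHereditary {V : Type*} (G : SimpleGraph V) : Prop :=
  ∀ s : Set V, (G.induce s).Connected →
    ∀ u v : s, (G.induce s).dist u v = G.dist (u : V) (v : V)

/-- Eccentricity of a vertex: `e(v) = max_{u} d(v,u)`. -/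
noncomputable def ecc {V : Type*} [Fintype V] (G : SimpleGraph V) (v : V) : ℕ :=
  Finset.univ.sup (fun u => G.dist v u)

/-- Radius: minimum eccentricity. -/
noncomputable def rad {V : Type*} [Fintype V] (G : SimpleGraph V) : ℕ :=
  sInf (Set.range (ecc G))

/-- Diameter: maximum eccentricity. -/
noncomputable def diam {V : Type*} [Fintype V] (G : SimpleGraph V) : ℕ :=
  Finset.univ.sup (fun v => ecc G v)

/-- The center: vertices of minimum eccentricity. -/
def center {V : Type*} [Fintype V] (G : SimpleGraph V) : Set V :=
  {v | ecc G v = rad G}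

/-- Distance from a vertex to a set of vertices: `d(v,S) = min_{s ∈ S} d(v,s)`. -/
noncomputable def distToSet {V : Type*} (G : SimpleGraph V) (v : V) (S : Set V) : ℕ :=
  sInf ((G.dist v) '' S)

/-- The interval `I(x,y)`: vertices on shortest `(x,y)`-paths. -/
def interval {V : Type*} (G : SimpleGraph V) (x y : V) : Set V :=
  {v | G.dist x v + G.dist v y = G.dist x y}

/-- The intervalSlice `S_k(x,y) = {v ∈ I(x,y) : d(x,v) = k}`. -/
def intervalSlice {V : Type*} (G : SimpleGraph V) (x y : V) (k : ℕ) : Set V :=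
  {v | v ∈ interval G x y ∧ G.dist x v = k}

/-- The set `S` induces a cograph in `G`: no induced path on four vertices within `S`. -/
def IsCographOn {V : Type*} (G : SimpleGraph V) (S : Set V) : Prop :=
  ¬ ∃ a b c d : V, a ∈ S ∧ b ∈ S ∧ c ∈ S ∧ d ∈ S ∧
    a ≠ c ∧ a ≠ d ∧ b ≠ d ∧
    G.Adj a b ∧ G.Adj b c ∧ G.Adj c d ∧ ¬ G.Adj a c ∧ ¬ G.Adj a d ∧ ¬ G.Adj b d

namespace SimpleGraph

variable {V : Type*} {G : SimpleGraph V}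

/-- A vertex on a shortest walk splits the distance between the endpoints. -/
theorem Walk.dist_add_dist_of_mem_support (hconn : G.Connected) {u v q : V} (p : G.Walk u v)
    (hp : p.length = G.dist u v) (hq : q ∈ p.support) :
    G.dist u q + G.dist q v = G.dist u v := by
  classical
  have hlen := congrArg Walk.length (p.take_spec hq)
  rw [Walk.length_append] at hlen
  have := dist_le (p.takeUntil q hq)
  have := dist_le (p.dropUntil q hq)
  have := hconn.dist_triangle (u := u) (v := q) (w := v)
  omega

theorem Walk.exists_mem_support_dist_eq (hconn : G.Connected) {u v : V} (p : G.Walk u v)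
    (hp : p.length = G.dist u v) {k : ℕ} (hk : k ≤ G.dist u v) :
    ∃ q ∈ p.support, G.dist u q = k ∧ G.dist q v + k = G.dist u v := by
  have hmem : p.getVert k ∈ p.support := p.getVert_mem_support k
  have hsplit := p.dist_add_dist_of_mem_support hconn hp hmem
  have htake := dist_le (p.take k)
  have hdrop := dist_le (p.drop k)
  rw [Walk.take_length] at htake
  rw [Walk.drop_length] at hdrop
  exact ⟨_, hmem, by omega, by omega⟩

theorem Connected.exists_adj_dist_add_one_eq (hconn : G.Connected) {o s : V}
    (hs : 0 < G.dist o s) : ∃ y, G.Adj y s ∧ G.dist o y + 1 = G.dist o s := by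
  obtain ⟨p, hp⟩ := hconn.exists_walk_length_eq_dist o s
  obtain ⟨y, -, hy, hys⟩ := p.exists_mem_support_dist_eq hconn hp (Nat.sub_le (G.dist o s) 1)
  exact ⟨y, dist_eq_one_iff_adj.1 (by omega), by omega⟩

theorem Connected.dist_le_dist_add_one (hconn : G.Connected) (o : V) {x y : V}
    (h : G.Adj x y) : G.dist o x ≤ G.dist o y + 1 := by
  have := hconn.dist_triangle (u := o) (v := y) (w := x)
  rwa [dist_eq_one_iff_adj.2 h.symm] at this

end SimpleGraph

namespace DistHereditary

open SimpleGraph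

variable {V : Type*} {G : SimpleGraph V}

/-- A connected vertex set contains a vertex at every level of a geodesic joining two of its
members. -/
theorem exists_mem_dist_eq (hconn : G.Connected) (hdh : DistHereditary G) {S : Set V}
    (hS : (G.induce S).Connected) {u v : V} (hu : u ∈ S) (hv : v ∈ S) {k : ℕ}
    (hk : k ≤ G.dist u v) :
    ∃ q ∈ S, G.dist u q = k ∧ G.dist q v + k = G.dist u v := by
  obtain ⟨p, hp⟩ := hS.exists_walk_length_eq_dist ⟨u, hu⟩ ⟨v, hv⟩
  have hlen := (Walk.length_map (Embedding.induce S).toHom p).trans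
    (hp.trans (hdh S hS ⟨u, hu⟩ ⟨v, hv⟩))
  obtain ⟨q, hq, hqk⟩ := Walk.exists_mem_support_dist_eq hconn _ hlen hk
  rw [Walk.support_map, List.mem_map] at hq
  obtain ⟨q', -, rfl⟩ := hq
  exact ⟨_, q'.2, hqk⟩

/-- Two vertices at the same distance from `o` that are joined by a walk staying at least as far
from `o` have the same neighbors one level closer to `o`. -/
theorem adj_of_walk (hconn : G.Connected) (hdh : DistHereditary G) {o s t y : V}
    (p : G.Walk s t) (hp : ∀ x ∈ p.support, G.dist o s ≤ G.dist o x)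
    (hst : G.dist o t = G.dist o s) (hys : G.Adj y s) (hy : G.dist o y + 1 = G.dist o s) :
    G.Adj y t := by
  obtain ⟨g, hg⟩ := hconn.exists_walk_length_eq_dist o y
  have hS := induce_union_connected (g.concat hys).connected_induce_support.preconnected
    p.connected_induce_support.preconnected
    ⟨s, (g.concat hys).end_mem_support, p.start_mem_support⟩
  obtain ⟨q, hq, hqo, hqt⟩ := hdh.exists_mem_dist_eq hconn hS
    (Or.inl (g.concat hys).start_mem_support) (Or.inr p.end_mem_support)
    (k := G.dist o y) (by omega)
  have hqy : q = y := by
    rcases hq with hq | hq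
    · simp only [Set.mem_ofPred_eq, Walk.support_concat, List.mem_append,
        List.mem_singleton] at hq
      rcases hq with hq | rfl
      · have := g.dist_add_dist_of_mem_support hconn hg hq
        exact hconn.dist_eq_zero_iff.1 (by omega)
      · omega
    · have := hp q hq
      omega
  subst hqy
  exact dist_eq_one_iff_adj.1 (by omega)

/-- A walk from `s` whose vertices adjacent to `s` are all at least as far from `o` as `s`
never gets closer to `o` than `s`. -/
theorem dist_le_of_mem_support (hconn : G.Connected) (hdh : DistHereditary G) {o s x t : V}
    (g : G.Walk s x) (hg : ∀ q ∈ g.support, G.dist o s ≤ G.dist o q)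
    (p : G.Walk x t) (hp : ∀ q ∈ p.support, G.Adj s q → G.dist o s ≤ G.dist o q) :
    ∀ q ∈ p.support, G.dist o s ≤ G.dist o q := by
  induction p with
  | nil =>
    intro q hq
    rw [Walk.support_nil, List.mem_singleton] at hq
    exact hg q (hq ▸ g.end_mem_support)
  | @cons x y t h p ih =>
    have hx := hg x g.end_mem_support
    have hxy := hconn.dist_le_dist_add_one o h
    have hy : G.dist o s ≤ G.dist o y := by
      by_contra hlt
      have hys : G.Adj y s := hdh.adj_of_walk hconn (o := o) g.reverse
        (fun q hq => by
          rw [Walk.support_reverse, List.mem_reverse] at hq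
          have := hg q hq
          omega)
        (by omega) h.symm (by omega)
      exact hlt (hp y (by simp) hys.symm)
    intro q hq
    rw [Walk.support_cons, List.mem_cons] at hq
    rcases hq with rfl | hq
    · exact hx
    · refine ih (g.concat h) (fun q hq => ?_) (fun q hq => hp q (by simp [hq])) q hq
      simp only [Walk.support_concat, List.mem_append,
        List.mem_singleton] at hq
      rcases hq with hq | rfl
      exacts [hg q hq, hy]

/-- If a shortest walk from `s` to `t` starts with a step to `w` that does not get closer to `o`,
then its continuation never gets closer to `o` than `s`. -/
theorem dist_le_of_mem_geodesic (hconn : G.Connected) (hdh : DistHereditary G) {o s w t : V}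
    (hsw : G.Adj s w) (ht : G.dist s t = G.dist w t + 1) (ho : G.dist o s ≤ G.dist o w)
    (p : G.Walk w t) (hp : p.length = G.dist w t) :
    ∀ q ∈ p.support, G.dist o s ≤ G.dist o q := by
  refine hdh.dist_le_of_mem_support hconn (.cons hsw .nil) (by simp [ho]) p fun q hq hsq => ?_
  have := p.dist_add_dist_of_mem_support hconn hp hq
  have hle := hconn.dist_triangle (u := s) (v := q) (w := t)
  rw [dist_eq_one_iff_adj.2 hsq] at hle
  have hwq : w = q := hconn.dist_eq_zero_iff.1 (by omega)
  exact hwq ▸ ho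

/-- If `w` starts a geodesic from `v` to `c` and `u` is at least as far from `w` as from `v`,
then `v` is at most as far from `u` as `c` is, with equality only if `d(v,c) ≤ 2`. -/
theorem dist_le_and_dist_le_two (hconn : G.Connected) (hdh : DistHereditary G) {v w c u : V}
    (hvw : G.Adj v w) (hc : G.dist v c = G.dist w c + 1) (hu : G.dist u v ≤ G.dist u w) :
    G.dist u v ≤ G.dist u c ∧ (G.dist u c = G.dist u v → G.dist v c ≤ 2) := by
  obtain ⟨p, hp⟩ := hconn.exists_walk_length_eq_dist w c
  have hall := hdh.dist_le_of_mem_geodesic hconn hvw hc hu p hp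
  refine ⟨hall c p.end_mem_support, fun heq => ?_⟩
  rcases Nat.eq_zero_or_pos (G.dist u v) with h0 | hpos
  · rw [← hconn.dist_eq_zero_iff.1 h0, hconn.dist_eq_zero_iff.1 (heq.trans h0),
      SimpleGraph.dist_self]
    omega
  · obtain ⟨y, hyv, hy⟩ := hconn.exists_adj_dist_add_one_eq hpos
    have hyc : G.Adj y c := hdh.adj_of_walk hconn (o := u) (.cons hvw p)
      (by simpa using hall) heq hyv hy
    exact dist_le (.cons hyv.symm (.cons hyc .nil))

/-- If `v` has a neighbor `a` with `d(a,u) < d(v,u)` and `d(a,z) > d(v,z)`, and a neighbor `b`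
with `d(b,u) > d(v,u)` and `d(b,z) ≤ d(v,z)`, then `v` lies on a geodesic from `z` to `u`. -/
theorem dist_eq_add_of_adj (hconn : G.Connected) (hdh : DistHereditary G) {v a b u z : V}
    (hva : G.Adj v a) (hvb : G.Adj v b) (hau : G.dist v u = G.dist a u + 1)
    (haz : G.dist z v < G.dist z a) (hbu : G.dist v u < G.dist b u)
    (hbz : G.dist z b ≤ G.dist z v) :
    G.dist z u = G.dist z v + G.dist v u := by
  rcases Nat.eq_zero_or_pos (G.dist z v) with h0 | hpos
  · rw [hconn.dist_eq_zero_iff.1 h0, SimpleGraph.dist_self, zero_add]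
  obtain ⟨y, hyv, hy, hyu⟩ : ∃ y, G.Adj y v ∧ G.dist z y + 1 = G.dist z v ∧
      G.dist v u ≤ G.dist y u := by
    rcases hbz.lt_or_eq with hlt | heq
    · have := hconn.dist_le_dist_add_one z hvb
      exact ⟨b, hvb.symm, by omega, by omega⟩
    · obtain ⟨y, hyv, hy⟩ := hconn.exists_adj_dist_add_one_eq hpos
      have hyb : G.Adj y b := hdh.adj_of_walk hconn (o := z) (.cons hvb .nil)
        (by simp [heq]) heq hyv hy
      have := hconn.dist_le_dist_add_one u hyb.symm
      rw [SimpleGraph.dist_comm, SimpleGraph.dist_comm (u := u) (v := y)] at this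
      exact ⟨y, hyv, hy, by omega⟩
  obtain ⟨p, hp⟩ := hconn.exists_walk_length_eq_dist a u
  have hall := hdh.dist_le_of_mem_geodesic hconn hva hau haz.le p hp
  have hfar : ∀ q ∈ p.support, G.dist z v < G.dist z q := by
    intro q hq
    refine lt_of_le_of_ne (hall q hq) fun heq => ?_
    classical
    have hyq : G.Adj y q := hdh.adj_of_walk hconn (o := z)
      (.cons hva (p.takeUntil q hq))
      (by
        simp only [Walk.support_cons, List.mem_cons, forall_eq_or_imp, le_refl, true_and]
        exact fun x hx => hall x (p.support_takeUntil_subset_support hq hx))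
      heq.symm hyv hy
    have hsplit := p.dist_add_dist_of_mem_support hconn hp hq
    have hle := hconn.dist_le_dist_add_one u hyq
    rw [SimpleGraph.dist_comm, SimpleGraph.dist_comm (u := u) (v := q)] at hle
    have haq : a = q := hconn.dist_eq_zero_iff.1 (by omega)
    rw [← haq] at heq
    omega
  obtain ⟨g, hg⟩ := hconn.exists_walk_length_eq_dist z y
  have hS := induce_union_connected (g.concat hyv).connected_induce_support.preconnected
    (Walk.cons hva p).connected_induce_support.preconnected
    ⟨v, (g.concat hyv).end_mem_support, (Walk.cons hva p).start_mem_support⟩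
  obtain ⟨q, hq, hqz, hqu⟩ := hdh.exists_mem_dist_eq hconn hS
    (Or.inl (g.concat hyv).start_mem_support) (Or.inr (Walk.cons hva p).end_mem_support)
    (k := G.dist z v) (hfar u p.end_mem_support).le
  have hqv : q = v := by
    rcases hq with hq | hq
    · simp only [Set.mem_ofPred_eq, Walk.support_concat, List.mem_append,
        List.mem_singleton] at hq
      rcases hq with hq | hq
      · have := g.dist_add_dist_of_mem_support hconn hg hq
        omega
      · exact hq
    · rcases List.mem_cons.1 hq with hq | hq
      · exact hq
      · have := hfar q hq
        omega
  subst hqv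
  omega

end DistHereditary

section Eccentricity

variable {V : Type*} [Fintype V] (G : SimpleGraph V)

theorem dist_le_ecc (v u : V) : G.dist v u ≤ ecc G v :=
  Finset.le_sup (f := fun u => G.dist v u) (Finset.mem_univ u)

theorem ecc_le_diam (v : V) : ecc G v ≤ diam G :=
  Finset.le_sup (f := fun v => ecc G v) (Finset.mem_univ v)

theorem exists_dist_eq_ecc (v : V) : ∃ u, G.dist v u = ecc G v := by
  obtain ⟨u, -, hu⟩ := Finset.exists_mem_eq_sup Finset.univ ⟨v, Finset.mem_univ v⟩
    (fun u => G.dist v u)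
  exact ⟨u, hu.symm⟩

theorem exists_ecc_eq_rad [Nonempty V] : ∃ c, ecc G c = rad G :=
  Nat.sInf_mem (Set.range_nonempty (ecc G))

variable {G}

theorem diam_le_two_mul_rad (hconn : G.Connected) : diam G ≤ 2 * rad G := by
  have := hconn.nonempty
  obtain ⟨c, hc⟩ := exists_ecc_eq_rad G
  refine Finset.sup_le fun x _ => Finset.sup_le fun y _ => ?_
  have := hconn.dist_triangle (u := x) (v := c) (w := y)
  have hx := dist_le_ecc G c x
  have := dist_le_ecc G c y
  rw [SimpleGraph.dist_comm] at hx
  omega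

/-- A vertex `u` witnessing that a neighbor `w` of `v` towards a central vertex `c` is not less
eccentric than `v` is at distance `rad G` from both `v` and `c`. -/
theorem DistHereditary.dist_eq_rad_of_ecc_le_dist (hconn : G.Connected) (hdh : DistHereditary G)
    {v w c u : V} (hv : rad G < ecc G v) (hcr : ecc G c = rad G) (hvw : G.Adj v w)
    (hc : G.dist v c = G.dist w c + 1) (hu : ecc G v ≤ G.dist u w) :
    ecc G v = rad G + 1 ∧ G.dist u v = rad G ∧ G.dist u c = rad G ∧ G.dist v c ≤ 2 := by
  have huv := dist_le_ecc G v u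
  have huc := dist_le_ecc G c u
  rw [SimpleGraph.dist_comm] at huv huc
  have := hconn.dist_le_dist_add_one u hvw.symm
  obtain ⟨hle, htwo⟩ := hdh.dist_le_and_dist_le_two hconn hvw hc (huv.trans hu)
  exact ⟨by omega, by omega, by omega, htwo (by omega)⟩

end Eccentricity

/-- In a finite connected distance-hereditary graph, if a non-central vertex `v`
has all neighbors `w` with `e(w) ≥ e(v)`, then `e(v) = rad(G) + 1` and `diam(G) = 2·rad(G)`. -/
theorem locality {V : Type*} [Fintype V] (G : SimpleGraph V)
    (hconn : G.Connected) (hdh : DistHereditary G) (v : V)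
    (hv : rad G < ecc G v)
    (hnb : ∀ w : V, G.Adj v w → ecc G v ≤ ecc G w) :
    ecc G v = rad G + 1 ∧ diam G = 2 * rad G := by
  classical
  have hne := hconn.nonempty
  obtain ⟨c, hcr⟩ := exists_ecc_eq_rad G
  have hvc : 0 < G.dist v c := Nat.pos_of_ne_zero fun h => by
    rw [← hconn.dist_eq_zero_iff.1 h] at hcr
    omega
  have hnadj : G.dist v c ≠ 1 := fun h => by
    have := hnb c (SimpleGraph.dist_eq_one_iff_adj.1 h)
    omega
  have hwit : ∀ w, G.Adj v w → ∃ u, ecc G v ≤ G.dist u w := fun w hw => by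
    obtain ⟨u, hu⟩ := exists_dist_eq_ecc G w
    exact ⟨u, by rw [SimpleGraph.dist_comm, hu]; exact hnb w hw⟩
  obtain ⟨w₀, hw₀v, hw₀⟩ := hconn.exists_adj_dist_add_one_eq
    (SimpleGraph.dist_comm (G := G) ▸ hvc)
  rw [SimpleGraph.dist_comm, SimpleGraph.dist_comm (u := c)] at hw₀
  obtain ⟨u₀, hu₀⟩ := hwit w₀ hw₀v.symm
  obtain ⟨hecc, -, -, htwo⟩ :=
    hdh.dist_eq_rad_of_ecc_le_dist hconn hv hcr hw₀v.symm hw₀.symm hu₀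
  have hdist : G.dist v c = 2 := by omega
  refine ⟨hecc, (diam_le_two_mul_rad hconn).antisymm ?_⟩
  let W : Finset V := {w | G.Adj v w ∧ G.Adj w c}
  obtain ⟨w, hwW, hmax⟩ := W.exists_max_image
    (fun w => ({z | G.dist z w ≤ rad G} : Finset V).card)
    ⟨w₀, by
      simpa [W] using ⟨hw₀v.symm, SimpleGraph.dist_eq_one_iff_adj.1 (by omega)⟩⟩
  have hW : ∀ {w}, w ∈ W → G.Adj v w ∧ G.dist v c = G.dist w c + 1 ∧ G.Adj w c := fun hw => by
    obtain ⟨h1, h2⟩ : _ ∧ _ := by simpa [W] using hw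
    exact ⟨h1, by rw [SimpleGraph.dist_eq_one_iff_adj.2 h2, hdist], h2⟩
  obtain ⟨hvw, hwc, hwcadj⟩ := hW hwW
  obtain ⟨u, hu⟩ := hwit w hvw
  obtain ⟨-, huv, huc, -⟩ := hdh.dist_eq_rad_of_ecc_le_dist hconn hv hcr hvw hwc hu
  have hrad : 0 < rad G := by
    have := dist_le_ecc G c v
    rw [SimpleGraph.dist_comm] at this
    omega
  obtain ⟨a, hav, ha⟩ := hconn.exists_adj_dist_add_one_eq (o := u) (s := v) (by omega)
  have hac : G.Adj a c := hdh.adj_of_walk hconn (o := u) (.cons hvw (.cons hwcadj .nil))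
    (by simp only [SimpleGraph.Walk.support_cons, SimpleGraph.Walk.support_nil, List.mem_cons,
          List.not_mem_nil, or_false, forall_eq_or_imp, forall_eq]
        omega)
    (by omega) hav ha
  have haW : a ∈ W := by simpa [W] using ⟨hav.symm, hac⟩
  obtain ⟨-, hac', -⟩ := hW haW
  obtain ⟨z, hzw, hza⟩ : ∃ z, G.dist z w ≤ rad G ∧ rad G < G.dist z a := by
    by_contra! hcon
    refine (hmax a haW).not_gt (Finset.card_lt_card ⟨fun z hz => ?_, fun hsub => ?_⟩)
    · simpa using hcon z (by simpa using hz)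
    · have hmem : u ∈ ({z | G.dist z w ≤ rad G} : Finset V) := hsub (by simp; omega)
      have : G.dist u w ≤ rad G := by simpa using hmem
      omega
  obtain ⟨-, hzv, -, -⟩ :=
    hdh.dist_eq_rad_of_ecc_le_dist hconn (u := z) hv hcr hav.symm hac' (by omega)
  have huv' : G.dist v u = rad G := by rw [SimpleGraph.dist_comm, huv]
  have hzu := hdh.dist_eq_add_of_adj hconn (u := u) (z := z) hav.symm hvw
    (by rw [huv', SimpleGraph.dist_comm]; omega) (by omega)
    (by rw [huv', SimpleGraph.dist_comm]; omega) (by omega)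
  have := (dist_le_ecc G z u).trans (ecc_le_diam G z)
  omega
end

section
/- Let G be a finite connected distance-hereditary graph, let x,y be a mutually distant pair of vertices, let u be any vertex and let v ∈ F(u). Set α = d(v,x) and β = d(v,y). Then max{α,β} ≤ d(x,y) ≤ max{ max{α,β}, min{α,β}+2 } ≤ max{α,β}+2. Moreover, if d(x,y) = max{α,β}+2, then α = β = d(x,y)−2 and d(u,x) = d(u,y) = d(u,v). -/
section

open SimpleGraph

/-- If no edge joins `P` and `T`, every walk from `P` to `T` inside `P ∪ {c} ∪ T` passes
through `c`. -/
lemma dist_add_dist_le_length_of_separates {V : Type*} {G : SimpleGraph V}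
    (hconn : G.Connected) {S P T : Set V} {c : V}
    (hS : ∀ z ∈ S, z ∈ P ∨ z = c ∨ z ∈ T) (hdisj : ∀ z ∈ P, z ∉ T)
    (hadj : ∀ a ∈ P, ∀ b ∈ T, ¬ G.Adj a b) {a b : S} (W : (G.induce S).Walk a b)
    (ha : (a : V) ∈ P) (hb : (b : V) ∈ T) :
    G.dist a c + G.dist c b ≤ W.length := by
  induction W with
  | nil => exact absurd hb (hdisj _ ha)
  | @cons a a' b h W ih =>
    have h' : G.Adj a a' := h
    have h1 : G.dist (a : V) a' = 1 := dist_eq_one_iff_adj.2 h'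
    rw [Walk.length_cons]
    rcases hS a' a'.2 with hP | hc | hT
    · have := ih hP hb
      have := hconn.dist_triangle (u := (a : V)) (v := a') (w := c)
      omega
    · subst hc
      have := dist_le (W.map (Embedding.induce S).toHom)
      rw [Walk.length_map] at this
      change G.dist (a' : V) b ≤ _ at this
      omega
    · exact absurd h' (hadj _ ha _ hT)

/-- A cut vertex of a connected induced subgraph of a distance-hereditary graph lies between
the vertices it separates. -/
lemma DistHereditary.dist_add_dist_le_of_separates {V : Type*} {G : SimpleGraph V}
    (hdh : DistHereditary G) (hconn : G.Connected) {S P T : Set V} {c : V}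
    (hSconn : (G.induce S).Connected)
    (hS : ∀ z ∈ S, z ∈ P ∨ z = c ∨ z ∈ T) (hdisj : ∀ z ∈ P, z ∉ T)
    (hadj : ∀ a ∈ P, ∀ b ∈ T, ¬ G.Adj a b) {a b : V} (haS : a ∈ S) (hbS : b ∈ S)
    (ha : a ∈ P) (hb : b ∈ T) :
    G.dist a c + G.dist c b ≤ G.dist a b := by
  obtain ⟨W, hW⟩ := hSconn.exists_walk_length_eq_dist ⟨a, haS⟩ ⟨b, hbS⟩
  have := dist_add_dist_le_length_of_separates hconn hS hdisj hadj W ha hb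
  rwa [hW, hdh S hSconn] at this

lemma dist_add_dist_eq_of_mem_support {V : Type*} {G : SimpleGraph V}
    (hconn : G.Connected) {a b z : V} (p : G.Walk a b) (hp : p.length = G.dist a b)
    (hz : z ∈ p.support) : G.dist a z + G.dist z b = G.dist a b := by
  classical
  have h1 := dist_le (p.takeUntil z hz)
  have h2 := dist_le (p.dropUntil z hz)
  have h3 := congrArg Walk.length (p.take_spec hz)
  rw [Walk.length_append] at h3
  have := hconn.dist_triangle (u := a) (v := z) (w := b)
  omega

/-- The four-point inequality of distance-hereditary graphs. -/
lemma DistHereditary.four_point {V : Type*} {G : SimpleGraph V}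
    (hdh : DistHereditary G) (hconn : G.Connected) (x y u v : V) :
    G.dist x y + G.dist u v ≤ G.dist x u + G.dist v y + 2 ∨
    G.dist x y + G.dist u v ≤ G.dist x v + G.dist u y := by
  obtain ⟨P, hP⟩ := hconn.exists_walk_length_eq_dist x u
  obtain ⟨Q, hQ⟩ := hconn.exists_walk_length_eq_dist v y
  obtain ⟨⟨p, q⟩, ⟨hp, hq⟩, hmin⟩ := WellFounded.has_min
    (measure fun z : V × V => G.dist z.1 z.2).wf
    {z : V × V | z.1 ∈ P.support ∧ z.2 ∈ Q.support}
    ⟨(x, v), P.start_mem_support, Q.start_mem_support⟩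
  dsimp only at hp hq
  replace hmin : ∀ a ∈ P.support, ∀ b ∈ Q.support, G.dist p q ≤ G.dist a b :=
    fun a ha b hb => not_lt.1 (hmin (a, b) ⟨ha, hb⟩)
  have tri : ∀ a b c : V, G.dist a c ≤ G.dist a b + G.dist b c :=
    fun a b c => hconn.dist_triangle
  obtain ⟨R, hR⟩ := hconn.exists_walk_length_eq_dist p q
  have near (h : G.dist p q ≤ 1) :
      G.dist x y + G.dist u v ≤ G.dist x u + G.dist v y + 2 := by
    have h1 := dist_add_dist_eq_of_mem_support hconn P hP hp
    have h2 := dist_add_dist_eq_of_mem_support hconn Q hQ hq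
    have := tri x p y
    have := tri p q y
    have := tri u p v
    have := tri p q v
    have := G.dist_comm (u := u) (v := p)
    have := G.dist_comm (u := q) (v := v)
    omega
  match R, hR with
  | .nil, hR => exact .inl (near (by simp))
  | .cons _ .nil, hR => exact .inl (near (by simp at hR; omega))
  | .cons (v := c) hpc (.cons (v := c') hcc R), hR =>
    simp only [Walk.length_cons] at hR
    let T : Set V := {z | z ∈ R.support} ∪ {z | z ∈ Q.support}
    have hT : ∀ t ∈ T, ∃ b ∈ Q.support, G.dist t b + 2 ≤ G.dist p q := by
      classical
      rintro t (ht | ht)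
      · have h1 := dist_le (R.dropUntil t ht)
        have h2 := R.length_dropUntil_le_length ht
        exact ⟨q, hq, by omega⟩
      · exact ⟨t, ht, by simp; omega⟩
    let S : Set V := ({z | z ∈ P.support} ∪
      {z | z ∈ (Walk.cons hpc (.cons hcc R)).support}) ∪ {z | z ∈ Q.support}
    have hSconn : (G.induce S).Connected :=
      induce_union_connected
        (induce_union_connected P.connected_induce_support.preconnected
          (Walk.connected_induce_support _).preconnected
          ⟨p, hp, Walk.start_mem_support _⟩).preconnected
        Q.connected_induce_support.preconnected
        ⟨q, .inr (Walk.end_mem_support _), hq⟩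
    have hS : ∀ z ∈ S, z ∈ {z | z ∈ P.support} ∨ z = c ∨ z ∈ T := by
      rintro z ((hz | hz) | hz)
      · exact .inl hz
      · simp only [Walk.support_cons, List.mem_cons, Set.mem_ofPred_eq] at hz
        rcases hz with rfl | rfl | hz
        · exact .inl hp
        · exact .inr (.inl rfl)
        · exact .inr (.inr (.inl hz))
      · exact .inr (.inr (.inr hz))
    have hdisj : ∀ z ∈ {z | z ∈ P.support}, z ∉ T := by
      intro z hz hzT
      obtain ⟨b, hb, hle⟩ := hT z hzT
      have := hmin z hz b hb
      omega
    have hadj : ∀ a ∈ {z | z ∈ P.support}, ∀ t ∈ T, ¬ G.Adj a t := by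
      intro a ha t ht hat
      obtain ⟨b, hb, hle⟩ := hT t ht
      have := hmin a ha b hb
      have := tri a t b
      have := dist_eq_one_iff_adj.2 hat
      omega
    have key : ∀ a ∈ P.support, ∀ b ∈ Q.support, G.dist a c + G.dist c b ≤ G.dist a b :=
      fun a ha b hb => hdh.dist_add_dist_le_of_separates hconn hSconn hS hdisj hadj
        (.inl (.inl ha)) (.inr hb) ha (.inr hb)
    have := key x P.start_mem_support v Q.start_mem_support
    have := key u P.end_mem_support y Q.end_mem_support
    have := tri x c y
    have := tri u c v
    exact .inr (by omega)

lemma dist_le_ecc_s8 {V : Type*} [Fintype V] (G : SimpleGraph V) (a b : V) :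
    G.dist a b ≤ ecc G a :=
  Finset.le_sup (f := fun b => G.dist a b) (Finset.mem_univ b)

end

/-- Let `x,y` be mutually distant, `u` any vertex, `v ∈ F(u)`,
`α = d(v,x)`, `β = d(v,y)`. Then
`max{α,β} ≤ d(x,y) ≤ max{max{α,β}, min{α,β}+2} ≤ max{α,β}+2`, and if
`d(x,y) = max{α,β}+2` then `α = β = d(x,y)−2` and `d(u,x) = d(u,y) = d(u,v)`. -/
theorem duality_two {V : Type*} [Fintype V] (G : SimpleGraph V)
    (hconn : G.Connected) (hdh : DistHereditary G) (x y u v : V)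
    (hxy : G.dist x y = ecc G x) (hyx : G.dist y x = ecc G y)
    (hv : G.dist u v = ecc G u) :
    max (G.dist v x) (G.dist v y) ≤ G.dist x y ∧
    G.dist x y ≤ max (max (G.dist v x) (G.dist v y)) (min (G.dist v x) (G.dist v y) + 2) ∧
    max (max (G.dist v x) (G.dist v y)) (min (G.dist v x) (G.dist v y) + 2) ≤
      max (G.dist v x) (G.dist v y) + 2 ∧
    (G.dist x y = max (G.dist v x) (G.dist v y) + 2 →
      G.dist v x + 2 = G.dist x y ∧ G.dist v y + 2 = G.dist x y ∧
      G.dist u x = G.dist u v ∧ G.dist u y = G.dist u v) := by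
  have h1 := hdh.four_point hconn x y u v
  have h2 := hdh.four_point hconn x y v u
  have := dist_le_ecc_s8 G x v
  have := dist_le_ecc_s8 G y v
  have := dist_le_ecc_s8 G u x
  have := dist_le_ecc_s8 G u y
  simp only [G.dist_comm (u := x) (v := u), G.dist_comm (u := x) (v := v),
    G.dist_comm (u := y) (v := x), G.dist_comm (u := y) (v := v),
    G.dist_comm (u := v) (v := u)] at *
  omega
end
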